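/- Let a < b be real numbers, let q ≥ 1, and let f be twice differentiable on an open interval containing [a,b] with f'' integrable on [a,b]. If |f''|^q is quasi-convex on [a,b], i.e. |f''(t x + (1−t) y)|^q ≤ max{ |f''(x)|^q, |f''(y)|^q } for all x, y ∈ [a,b] and t ∈ [0,1], then | (f(a)+f(b))/2 − (1/(b−a)) ∫_a^b f(x) dx | ≤ ((b−a)²/12) ( max{ |f''(a)|^q, |f''(b)|^q } )^{1/q}. -/

import Mathlib

theorem integral_sub_mul_sub (a b : ℝ) :
    ∫ x in a..b, (x - a) * (b - x) = (b - a) ^ 3 / 6 := by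
  have hderiv : ∀ x ∈ Set.uIcc a b,
      HasDerivAt (fun x : ℝ => (b - a) * (x - a) ^ 2 / 2 - (x - a) ^ 3 / 3)
        ((x - a) * (b - x)) x := by
    intro x _
    have h : HasDerivAt (fun x : ℝ => x - a) 1 x := (hasDerivAt_id x).sub_const a
    refine ((((h.fun_pow 2).const_mul (b - a)).div_const 2).fun_sub
      ((h.fun_pow 3).div_const 3)).congr_deriv ?_
    norm_num
    ring
  rw [intervalIntegral.integral_eq_sub_of_hasDerivAt hderiv
    (by apply Continuous.intervalIntegrable; fun_prop)]
  ring

/-- The Peano kernel form of the error of the trapezoidal rule. -/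
theorem integral_sub_mul_sub_mul_deriv_deriv {a b : ℝ} {f f' f'' : ℝ → ℝ}
    (hf' : ∀ x ∈ Set.uIcc a b, HasDerivAt f (f' x) x)
    (hf'' : ∀ x ∈ Set.uIcc a b, HasDerivAt f' (f'' x) x)
    (hint : IntervalIntegrable f'' MeasureTheory.volume a b) :
    ∫ x in a..b, (x - a) * (b - x) * f'' x = (b - a) * (f a + f b) - 2 * ∫ x in a..b, f x := by
  have hf_int : IntervalIntegrable f MeasureTheory.volume a b :=
    ContinuousOn.intervalIntegrable fun x hx => (hf' x hx).continuousAt.continuousWithinAt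
  have hker_int : IntervalIntegrable (fun x => (x - a) * (b - x) * f'' x)
      MeasureTheory.volume a b :=
    hint.continuousOn_mul (by fun_prop)
  have hderiv : ∀ x ∈ Set.uIcc a b,
      HasDerivAt (fun x => (x - a) * (b - x) * f' x + (2 * x - a - b) * f x)
        ((x - a) * (b - x) * f'' x + 2 * f x) x := by
    intro x hx
    have ha : HasDerivAt (fun x : ℝ => x - a) 1 x := (hasDerivAt_id x).sub_const a
    have hb : HasDerivAt (fun x : ℝ => b - x) (-1) x := (hasDerivAt_id x).const_sub b
    have hm : HasDerivAt (fun x : ℝ => 2 * x - a - b) (2 * 1) x :=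
      (((hasDerivAt_id x).const_mul 2).sub_const a).sub_const b
    refine (((ha.fun_mul hb).fun_mul (hf'' x hx)).fun_add (hm.fun_mul (hf' x hx))).congr_deriv ?_
    ring
  have h := intervalIntegral.integral_eq_sub_of_hasDerivAt hderiv
    (hker_int.add (hf_int.const_mul 2))
  rw [intervalIntegral.integral_add hker_int (hf_int.const_mul 2),
    intervalIntegral.integral_const_mul] at h
  linear_combination h

theorem stmt_14 (a b q : ℝ) (f f' f'' : ℝ → ℝ) (A B : ℝ)
    (hab : a < b) (hq : 1 ≤ q) (hA : A < a) (hB : b < B)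
    (hf' : ∀ x ∈ Set.Ioo A B, HasDerivAt f (f' x) x)
    (hf'' : ∀ x ∈ Set.Ioo A B, HasDerivAt f' (f'' x) x)
    (hint : IntervalIntegrable f'' MeasureTheory.volume a b)
    (hqc : ∀ x ∈ Set.Icc a b, ∀ y ∈ Set.Icc a b, ∀ t ∈ Set.Icc (0:ℝ) 1,
      |f'' (t * x + (1 - t) * y)| ^ q ≤ max (|f'' x| ^ q) (|f'' y| ^ q)) :
    |(f a + f b) / 2 - (1 / (b - a)) * ∫ x in a..b, f x|
      ≤ ((b - a) ^ 2 / 12) * (max (|f'' a| ^ q) (|f'' b| ^ q)) ^ (1 / q) := by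
  have hsub : Set.uIcc a b ⊆ Set.Ioo A B := by
    rw [Set.uIcc_of_le hab.le]
    exact Set.Icc_subset_Ioo hA hB
  have hpos : 0 < b - a := sub_pos.mpr hab
  have hq0 : 0 < q := by linarith
  set K := (max (|f'' a| ^ q) (|f'' b| ^ q)) ^ (1 / q) with hK
  have hbound : ∀ x ∈ Set.Icc a b, |f'' x| ≤ K := by
    intro x hx
    have h := hqc a (Set.left_mem_Icc.mpr hab.le) b (Set.right_mem_Icc.mpr hab.le)
      ((b - x) / (b - a)) ⟨div_nonneg (by linarith [hx.2]) hpos.le,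
        (div_le_one hpos).mpr (by linarith [hx.1])⟩
    have hx_eq : (b - x) / (b - a) * a + (1 - (b - x) / (b - a)) * b = x := by
      field_simp
      ring
    rw [hx_eq] at h
    rw [hK, one_div, Real.le_rpow_inv_iff_of_pos (abs_nonneg _) (by positivity) hq0]
    exact h
  have hkernel := integral_sub_mul_sub_mul_deriv_deriv (fun x hx => hf' x (hsub hx))
    (fun x hx => hf'' x (hsub hx)) hint
  have hle : |∫ x in a..b, (x - a) * (b - x) * f'' x| ≤ (b - a) ^ 3 / 6 * K := by
    rw [← integral_sub_mul_sub, ← intervalIntegral.integral_mul_const, ← Real.norm_eq_abs]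
    refine intervalIntegral.norm_integral_le_of_norm_le hab.le (.of_forall fun x hx => ?_)
      (by apply Continuous.intervalIntegrable; fun_prop)
    have hx0 : 0 ≤ (x - a) * (b - x) :=
      mul_nonneg (sub_nonneg.mpr hx.1.le) (sub_nonneg.mpr hx.2)
    rw [Real.norm_eq_abs, abs_mul, abs_of_nonneg hx0]
    exact mul_le_mul_of_nonneg_left (hbound x (Set.Ioc_subset_Icc_self hx)) hx0
  have herror : (f a + f b) / 2 - (1 / (b - a)) * ∫ x in a..b, f x
      = (∫ x in a..b, (x - a) * (b - x) * f'' x) / (2 * (b - a)) := by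
    rw [hkernel]
    field_simp
  rw [herror, abs_div, abs_of_pos (by positivity : 0 < 2 * (b - a)),
    div_le_iff₀ (by positivity)]
  linarith
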